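/- Let k be a field of characteristic zero and G a finite subgroup of SL_d(k) acting on S = k[x_1,…,x_d] with invariant subring R = S^G, and assume R is an isolated singularity (equivalently, G acts freely on k^d ∖ {0}). Then Ext^j_R(S, S) = 0 for all j with 0 < j < d − 1, where S is regarded as an R-module. -/

import Mathlib

open MvPolynomial Matrix

noncomputable section

variable (k : Type) [Field k] (d : ℕ)

def matAct (M : Matrix (Fin d) (Fin d) k) :
    MvPolynomial (Fin d) k →ₐ[k] MvPolynomial (Fin d) k :=
  aeval fun i => ∑ j, M j i • X j

/-- The invariant subalgebra `R = S^G` of a subgroup `G ≤ SL_d(k)`. -/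
def invRSL (G : Subgroup (Matrix.SpecialLinearGroup (Fin d) k)) :
    Subalgebra k (MvPolynomial (Fin d) k) where
  carrier := {s | ∀ g ∈ G, matAct k d (g : Matrix (Fin d) (Fin d) k) s = s}
  mul_mem' ha hb := fun g hg => by rw [_root_.map_mul, ha g hg, hb g hg]
  add_mem' ha hb := fun g hg => by rw [_root_.map_add, ha g hg, hb g hg]
  algebraMap_mem' r := fun g hg => (matAct k d _).commutes r

/-- A commutative ring is regular local if it is Noetherian local and its maximal ideal
is generated by `dim A` elements. -/
def IsRegularLocal (A : Type) [CommRing A] : Prop :=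
  IsNoetherianRing A ∧ ∃ (h : IsLocalRing A) (n : ℕ) (s : Fin n → A),
    Ideal.span (Set.range s) = @IsLocalRing.maximalIdeal A _ h ∧ ringKrullDim A = n

/-- The graded ('irrelevant') maximal ideal `m` of `R = S^G`: the contraction of the
irrelevant ideal `(x_1,…,x_d)` of `S`. -/
def irrId (G : Subgroup (Matrix.SpecialLinearGroup (Fin d) k)) : Ideal ↥(invRSL k d G) :=
  Ideal.comap (algebraMap ↥(invRSL k d G) (MvPolynomial (Fin d) k))
    (Ideal.span (Set.range (X : Fin d → MvPolynomial (Fin d) k)))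

/-- `R = S^G` is an isolated singularity: `R_p` is regular for every prime `p ≠ m`. -/
def IsIsolatedSing (G : Subgroup (Matrix.SpecialLinearGroup (Fin d) k)) : Prop :=
  ∀ (p : Ideal ↥(invRSL k d G)) (hp : p.IsPrime), p ≠ irrId k d G →
    IsRegularLocal (Localization (@Ideal.primeCompl _ _ p hp))

section GenericExt

open Finset

variable {R S G : Type} [CommRing R] [CommRing S] [Algebra R S] [Group G] [Fintype G]
  [MulSemiringAction G S]

variable (S G) in
/-- The `S`-subalgebra of `G → S` generated by the functions `g ↦ g • b`. -/
def orbAlg : Subalgebra S (G → S) :=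
  Algebra.adjoin S (Set.range fun (b : S) (g : G) => g • b)

variable (S G) in
lemma orbAlg_eq_span : Subalgebra.toSubmodule (orbAlg S G) =
    Submodule.span S (Set.range fun (b : S) (g : G) => g • b) := by
  unfold orbAlg
  rw [Algebra.adjoin_eq_span]
  congr 1
  let M : Submonoid (G → S) :=
    { carrier := Set.range fun (b : S) (g : G) => g • b
      mul_mem' := by
        rintro _ _ ⟨a, rfl⟩ ⟨b, rfl⟩
        exact ⟨a * b, by ext g; simp⟩
      one_mem' := ⟨1, by ext g; simp⟩ }
  exact congrArg SetLike.coe (Submonoid.closure_eq M)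

variable (S G) in
open Classical in
/-- The ideal of those `f` such that `f δ_1` lies in `orbAlg`. -/
def goodIdeal : Ideal S :=
  (Subalgebra.toSubmodule (orbAlg S G)).comap (LinearMap.single S (fun _ : G => S) 1)

open Classical in
lemma mem_goodIdeal_exists {f : S} (hf : f ∈ goodIdeal S G) :
    ∃ (n : ℕ) (a b : Fin n → S), ∀ g : G, ∑ i, a i * g • b i = if g = 1 then f else 0 := by
  have h : (Pi.single 1 f : G → S) ∈ Subalgebra.toSubmodule (orbAlg S G) := hf
  rw [orbAlg_eq_span] at h
  obtain ⟨n, a, b, h⟩ := Submodule.mem_span_set'.1 h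
  choose c hc using fun i => (b i).2
  refine ⟨n, a, c, fun g => ?_⟩
  have := congrFun h g
  rw [Pi.single_apply] at this
  rw [← this]
  simp only [Finset.sum_apply, Pi.smul_apply, smul_eq_mul, ← hc]

lemma prod_mem_goodIdeal (s : G → S) (f : S) (h : ∀ g : G, g ≠ 1 → s g - g⁻¹ • s g = f) :
    f ^ (Fintype.card G - 1) ∈ goodIdeal S G := by
  classical
  change (Pi.single 1 (f ^ (Fintype.card G - 1)) : G → S) ∈ orbAlg S G
  have : (Pi.single 1 (f ^ (Fintype.card G - 1)) : G → S) =
      ∏ g ∈ univ.erase (1 : G), (algebraMap S (G → S) (s g) - fun h => h • (g⁻¹ • s g)) := by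
    ext h0
    rw [Finset.prod_apply]
    by_cases h1 : h0 = 1
    · subst h1
      rw [Pi.single_eq_same, Finset.prod_congr rfl (g := fun _ => f)]
      · simp [Finset.card_erase_of_mem]
      · intro g hg
        simpa using h g (Finset.ne_of_mem_erase hg)
    · rw [Pi.single_eq_of_ne h1]
      symm
      apply Finset.prod_eq_zero (i := h0) (by simpa using h1)
      simp
  rw [this]
  refine prod_mem fun g _ => sub_mem (Subalgebra.algebraMap_mem _ _) ?_
  exact Algebra.subset_adjoin ⟨g⁻¹ • s g, rfl⟩

variable (R S G) in
/-- The ideal generated by the invariant good elements. -/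
def invGood : Ideal S :=
  Ideal.span (algebraMap R S '' {r | algebraMap R S r ∈ goodIdeal S G})

lemma invGood_le : invGood R S G ≤ goodIdeal S G := by
  unfold invGood
  rw [Ideal.span_le]
  rintro _ ⟨r, hr, rfl⟩
  exact hr

/-- For a `G`-stable ideal, every element lies in the radical of the extension of the
contraction. -/
lemma mem_radical_of_stable [Nontrivial S] [Algebra.IsInvariant R S G] (I : Ideal S)
    (hI : ∀ (g : G), ∀ f ∈ I, g • f ∈ I) (f : S) (hf : f ∈ I) :
    f ∈ ((I.comap (algebraMap R S)).map (algebraMap R S)).radical := by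
  set P := MulSemiringAction.charpoly G f with hP
  have hmon : P.Monic := MulSemiringAction.monic_charpoly G f
  have hev : P.eval f = 0 := MulSemiringAction.eval_charpoly G f
  refine ⟨P.natDegree, ?_⟩
  rw [Polynomial.eval_eq_sum_range, Finset.sum_range_succ, hmon.coeff_natDegree, one_mul] at hev
  rw [eq_neg_of_add_eq_zero_right hev]
  refine neg_mem (sum_mem fun i hi => Ideal.mul_mem_right _ _ ?_)
  obtain ⟨r, hr⟩ := Algebra.IsInvariant.isInvariant (A := R) (G := G) (P.coeff i)
    (fun g => MulSemiringAction.smul_coeff_charpoly f i g)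
  rw [← hr]
  apply Ideal.mem_map_of_mem
  rw [Ideal.mem_comap, hr, ← Ideal.Quotient.eq_zero_iff_mem, ← Polynomial.coeff_map]
  have : P.map (Ideal.Quotient.mk I) = Polynomial.X ^ (Fintype.card G) := by
    rw [hP, MulSemiringAction.charpoly_eq, Polynomial.map_prod]
    rw [Finset.prod_congr rfl (g := fun _ => Polynomial.X)]
    · simp
    · intro g _
      simp [Ideal.Quotient.eq_zero_iff_mem.2 (hI g f hf)]
  have hdeg : P.natDegree = Fintype.card G := by
    rw [hP, MulSemiringAction.charpoly_eq, Polynomial.natDegree_prod_of_monic]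
    · simp
    · exact fun g _ => Polynomial.monic_X_sub_C _
  rw [this, Polynomial.coeff_X_pow, if_neg]
  rw [← hdeg]
  exact (Finset.mem_range.1 hi).ne

variable [SMulCommClass G R S]

variable (R G) in
/-- trace -/
def trR [Algebra.IsInvariant R S G] (hinj : Function.Injective (algebraMap R S)) : S →ₗ[R] R := by
  have h : ∀ s : S, ∃ r : R, algebraMap R S r = ∑ g : G, g • s := fun s =>
    Algebra.IsInvariant.isInvariant (G := G) _ fun g => by
      rw [Finset.smul_sum]
      simp only [smul_smul]
      exact Equiv.sum_comp (Equiv.mulLeft g) (fun h => h • s)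
  choose t ht using h
  refine { toFun := t, map_add' := ?_, map_smul' := ?_ }
  · intro a b
    apply hinj
    simp [ht, Finset.sum_add_distrib]
  · intro r a
    apply hinj
    simp [ht, Algebra.smul_def, Finset.mul_sum]

lemma algebraMap_trR [Algebra.IsInvariant R S G] (hinj : Function.Injective (algebraMap R S))
    (s : S) : algebraMap R S (trR R G hinj s) = ∑ g : G, g • s := by
  have h : ∀ s : S, ∃ r : R, algebraMap R S r = ∑ g : G, g • s := fun s =>
    Algebra.IsInvariant.isInvariant (G := G) _ fun g => by
      rw [Finset.smul_sum]
      simp only [smul_smul]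
      exact Equiv.sum_comp (Equiv.mulLeft g) (fun h => h • s)
  exact (Classical.choose_spec (h s))

/-- Multiplication by a good element factors through a free module. -/
lemma good_factor [Algebra.IsInvariant R S G] (hinj : Function.Injective (algebraMap R S))
    {f : S} (hf : f ∈ goodIdeal S G) :
    ∃ (n : ℕ) (a b : Fin n → S),
      (∀ s, f * s = ∑ i, trR R G hinj (s * b i) • a i) := by
  classical
  obtain ⟨n, a, b, h⟩ := mem_goodIdeal_exists hf
  refine ⟨n, a, b, fun s => ?_⟩
  simp only [Algebra.smul_def, algebraMap_trR, smul_mul', Finset.sum_mul]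
  rw [Finset.sum_comm]
  have : ∀ g : G, ∑ i, g • s * g • b i * a i = if g = 1 then f * s else 0 := by
    intro g
    have := congrArg (fun z => g • s * z) (h g)
    simp only [Finset.mul_sum] at this
    calc _ = ∑ i, g • s * (a i * g • b i) := Finset.sum_congr rfl fun i _ => by ring
      _ = _ := this
      _ = _ := by split_ifs with h1 <;> simp [h1, mul_comm]
  simp [this]

variable {M : Type} [AddCommGroup M] [Module R M] [Module S M] [IsScalarTower R S M]

lemma good_decomp [Algebra.IsInvariant R S G] (hinj : Function.Injective (algebraMap R S))
    (φ : S →ₗ[R] M) {y : S} (hy : y ∈ invGood R S G) :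
    ∃ c : G → M, ∀ s, y • φ s = ∑ g : G, (g • s) • c g := by
  unfold invGood at hy
  induction hy using Submodule.span_induction with
  | mem x h =>
    obtain ⟨r, hr, rfl⟩ := h
    obtain ⟨n, a, b, h⟩ := good_factor hinj hr
    refine ⟨fun g => ∑ i, (g • b i) • φ (a i), fun s => ?_⟩
    rw [algebraMap_smul, ← map_smul, Algebra.smul_def, h, map_sum]
    simp only [map_smul, Finset.smul_sum]
    rw [Finset.sum_comm]
    refine Finset.sum_congr rfl fun i _ => ?_
    rw [← algebraMap_smul S, algebraMap_trR, Finset.sum_smul]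
    simp [smul_smul]
  | zero => exact ⟨0, by simp⟩
  | add x y _ _ hx hy =>
    obtain ⟨c, hc⟩ := hx
    obtain ⟨c', hc'⟩ := hy
    exact ⟨c + c', fun s => by simp [add_smul, hc, hc', Finset.sum_add_distrib]⟩
  | smul a x _ hx =>
    obtain ⟨c, hc⟩ := hx
    refine ⟨fun g => a • c g, fun s => ?_⟩
    rw [smul_assoc, hc, Finset.smul_sum]
    exact Finset.sum_congr rfl fun g _ => smul_comm _ _ _

lemma good_unique {f : S} (hf : f ∈ goodIdeal S G) (c : G → M)
    (h : ∀ s : S, ∑ g : G, (g • s) • c g = 0) (g₀ : G) : f • c g₀ = 0 := by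
  classical
  obtain ⟨n, a, b, hab⟩ := mem_goodIdeal_exists hf
  have : ∑ i, a i • ∑ g : G, (g • (g₀⁻¹ • b i)) • c g = 0 := by simp [h]
  simp only [Finset.smul_sum, smul_smul] at this
  rw [Finset.sum_comm] at this
  simp only [← Finset.sum_smul, hab] at this
  simpa [mul_inv_eq_one] using this

lemma hom_decomp [Algebra.IsInvariant R S G] (hinj : Function.Injective (algebraMap R S))
    {y₁ y₂ : S} (h₁ : y₁ ∈ invGood R S G) (h₂ : y₂ ∈ invGood R S G)
    (hr₁ : IsSMulRegular M y₁) (hr₂ : IsSMulRegular (QuotSMulTop y₁ M) y₂) (φ : S →ₗ[R] M) :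
    ∃ c : G → M, ∀ s, φ s = ∑ g : G, (g • s) • c g := by
  obtain ⟨c₁, hc₁⟩ := good_decomp hinj φ h₁
  obtain ⟨c₂, hc₂⟩ := good_decomp hinj φ h₂
  have key : ∀ g, y₂ • c₁ g = y₁ • c₂ g := by
    intro g
    rw [← sub_eq_zero]
    apply hr₁
    simp only [smul_zero]
    refine good_unique (invGood_le h₁) (fun g => y₂ • c₁ g - y₁ • c₂ g) (fun s => ?_) g
    simp only [smul_sub, Finset.sum_sub_distrib]
    have e1 : ∑ g : G, (g • s) • y₂ • c₁ g = y₂ • y₁ • φ s := by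
      rw [hc₁, Finset.smul_sum]
      exact Finset.sum_congr rfl fun g _ => smul_comm _ _ _
    have e2 : ∑ g : G, (g • s) • y₁ • c₂ g = y₁ • y₂ • φ s := by
      rw [hc₂, Finset.smul_sum]
      exact Finset.sum_congr rfl fun g _ => smul_comm _ _ _
    rw [e1, e2, smul_comm, sub_self]
  have : ∀ g, ∃ m, c₁ g = y₁ • m := by
    intro g
    have : (Submodule.Quotient.mk (c₁ g) : QuotSMulTop y₁ M) = 0 := by
      apply hr₂
      simp only [smul_zero]
      rw [← Submodule.Quotient.mk_smul, key, Submodule.Quotient.mk_eq_zero]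
      exact Submodule.smul_mem_pointwise_smul _ _ _ trivial
    rw [Submodule.Quotient.mk_eq_zero, Submodule.mem_smul_pointwise_iff_exists] at this
    obtain ⟨m, -, hm⟩ := this
    exact ⟨m, hm.symm⟩
  choose c hc using this
  refine ⟨c, fun s => hr₁ ?_⟩
  simp only
  rw [hc₁, Finset.smul_sum]
  exact Finset.sum_congr rfl fun g _ => by rw [hc, smul_comm]


open CategoryTheory Abelian
open scoped Pointwise

variable (R S M) in
/-- multiplication by `y` on `M` as a morphism of `R`-modules. -/
def mulHom (y : S) : ModuleCat.of R M ⟶ ModuleCat.of R M :=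
  ModuleCat.ofHom (LinearMap.restrictScalars R (LinearMap.lsmul S M y))

lemma ext_smul_eq_zero [Algebra.IsInvariant R S G] (hinj : Function.Injective (algebraMap R S))
    {r : R} (hr : algebraMap R S r ∈ goodIdeal S G) {Y : ModuleCat.{0} R} {j : ℕ}
    (z : Ext (ModuleCat.of R S) Y (j + 1)) : r • z = 0 := by
  obtain ⟨n, a, b, h⟩ := good_factor hinj hr
  let F : ModuleCat.{0} R := ModuleCat.of R (Fin n → R)
  let u : ModuleCat.of R S ⟶ F := ModuleCat.ofHom
    (LinearMap.pi fun i => (trR R G hinj) ∘ₗ (LinearMap.mulRight R (b i)))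
  let v : F ⟶ ModuleCat.of R S := ModuleCat.ofHom (Fintype.linearCombination R a)
  have huv : r • 𝟙 (ModuleCat.of R S) = u ≫ v := by
    ext s
    have := h s
    rw [← Algebra.smul_def] at this
    change r • s = Fintype.linearCombination R a _
    rw [Fintype.linearCombination_apply]
    exact this
  have : Projective F := by
    have : Module.Projective R (Fin n → R) := inferInstance
    exact (IsProjective.iff_projective F).1 inferInstance
  have e : r • z = (Ext.mk₀ (u ≫ v)).comp z (zero_add _) := by
    rw [← huv, Ext.mk₀_smul, Ext.smul_comp, Ext.mk₀_id_comp]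
  rw [e, ← Ext.mk₀_comp_mk₀, Ext.comp_assoc_of_second_deg_zero]
  rw [Ext.eq_zero_of_projective ((Ext.mk₀ v).comp z (zero_add _)), Ext.comp_zero]

lemma ext_comp_mulHom [Algebra.IsInvariant R S G] (hinj : Function.Injective (algebraMap R S))
    {y : S} (hy : y ∈ invGood R S G) {j : ℕ}
    (z : Ext (ModuleCat.of R S) (ModuleCat.of R M) (j + 1)) :
    z.comp (Ext.mk₀ (mulHom R S M y)) (add_zero _) = 0 := by
  unfold invGood at hy
  have hadd : ∀ a b : S, mulHom R S M (a + b) = mulHom R S M a + mulHom R S M b := by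
    intro a b
    ext m
    exact add_smul a b m
  induction hy using Submodule.span_induction with
  | mem x h =>
    obtain ⟨r, hr, rfl⟩ := h
    have : mulHom R S M (algebraMap R S r) = r • 𝟙 _ := by
      ext m
      simp [mulHom]
    rw [this, Ext.mk₀_smul, Ext.comp_smul, Ext.comp_mk₀_id]
    exact ext_smul_eq_zero hinj hr z
  | zero =>
    have : mulHom R S M (0 : S) = 0 := by
      ext m
      simp [mulHom]
    rw [this, Ext.mk₀_zero, Ext.comp_zero]
  | add x y _ _ hx hy =>
    rw [hadd, Ext.mk₀_add, Ext.comp_add, hx, hy, add_zero]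
  | smul a x _ hx =>
    have : mulHom R S M (a • x) = mulHom R S M x ≫ mulHom R S M a := by
      ext m
      exact mul_smul a x m
    rw [this, ← Ext.mk₀_comp_mk₀, ← Ext.comp_assoc_of_second_deg_zero, hx, Ext.zero_comp]

variable (R S M) in
/-- the projection. -/
def quotHom (y : S) : ModuleCat.of R M ⟶ ModuleCat.of R (QuotSMulTop y M) :=
  ModuleCat.ofHom ((Submodule.mkQ (y • (⊤ : Submodule S M))).restrictScalars R)

variable (R M) in
lemma mulHom_shortExact (y : S) (hy : IsSMulRegular M y) :
    ∃ w : mulHom R S M y ≫ quotHom R S M y = 0,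
      (ShortComplex.mk (mulHom R S M y) (quotHom R S M y) w).ShortExact := by
  have w : mulHom R S M y ≫ quotHom R S M y = 0 := by
    ext m
    simp only [mulHom, quotHom, ModuleCat.hom_comp, ModuleCat.hom_ofHom, LinearMap.comp_apply]
    exact (Submodule.Quotient.mk_eq_zero _).2 (Submodule.smul_mem_pointwise_smul _ _ _ trivial)
  refine ⟨w, { exact := ?_, mono_f := ?_, epi_g := ?_ }⟩
  · rw [ShortComplex.moduleCat_exact_iff]
    intro m hm
    have hm' : (Submodule.Quotient.mk m : QuotSMulTop y M) = 0 := hm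
    rw [Submodule.Quotient.mk_eq_zero, Submodule.mem_smul_pointwise_iff_exists] at hm'
    obtain ⟨m', -, hm'⟩ := hm'
    exact ⟨m', hm'⟩
  · exact (ModuleCat.mono_iff_injective _).2 hy
  · refine (ModuleCat.epi_iff_surjective _).2 fun m => ?_
    obtain ⟨m', hm'⟩ := Submodule.mkQ_surjective (y • (⊤ : Submodule S M)) m
    exact ⟨m', hm'⟩

lemma ext_step [Algebra.IsInvariant R S G] (hinj : Function.Injective (algebraMap R S))
    {y : S} (hy : y ∈ invGood R S G) (hr : IsSMulRegular M y) {j : ℕ}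
    (hs : ∀ z : Ext (ModuleCat.of R S) (ModuleCat.of R (QuotSMulTop y M)) j,
      ∃ z' : Ext (ModuleCat.of R S) (ModuleCat.of R M) j,
        z'.comp (Ext.mk₀ (quotHom R S M y)) (add_zero _) = z)
    (z : Ext (ModuleCat.of R S) (ModuleCat.of R M) (j + 1)) : z = 0 := by
  obtain ⟨w, hS⟩ := mulHom_shortExact R M y hr
  obtain ⟨x, hx⟩ := Ext.covariant_sequence_exact₁ _ hS z (ext_comp_mulHom hinj hy z) rfl
  obtain ⟨z', hz'⟩ := hs x
  rw [← hx, ← hz', Ext.comp_assoc_of_second_deg_zero]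
  have : (Ext.mk₀ (quotHom R S M y)).comp hS.extClass (zero_add 1) = 0 := hS.comp_extClass
  rw [this, Ext.comp_zero]

open RingTheory.Sequence in
theorem ext_vanish [Algebra.IsInvariant R S G] (hinj : Function.Injective (algebraMap R S)) :
    ∀ (j : ℕ) (M : Type) [AddCommGroup M] [Module R M] [Module S M] [IsScalarTower R S M]
    (ys : List S), (∀ y ∈ ys, y ∈ invGood R S G) → j + 3 ≤ ys.length → IsWeaklyRegular M ys →
    ∀ z : Ext (ModuleCat.of R S) (ModuleCat.of R M) (j + 1), z = 0 := by
  intro j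
  induction j with
  | zero =>
    intro M _ _ _ _ ys hys hlen hreg
    match ys, hlen with
    | y₁ :: y₂ :: y₃ :: ys, _ =>
    rw [isWeaklyRegular_cons_iff, isWeaklyRegular_cons_iff, isWeaklyRegular_cons_iff] at hreg
    refine ext_step hinj (hys y₁ (by simp)) hreg.1 fun z => ?_
    obtain ⟨f, rfl⟩ := Ext.mk₀_bijective _ _ |>.2 z
    obtain ⟨c, hc⟩ := hom_decomp hinj (hys y₂ (by simp)) (hys y₃ (by simp)) hreg.2.1 hreg.2.2.1
      f.hom
    choose c' hc' using fun g => Submodule.mkQ_surjective (y₁ • (⊤ : Submodule S M)) (c g)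
    let φ : S →ₗ[R] M :=
      { toFun := fun s => ∑ g : G, (g • s) • c' g
        map_add' := fun a b => by simp [add_smul, Finset.sum_add_distrib]
        map_smul' := fun r a => by
          simp only [RingHom.id_apply, Finset.smul_sum]
          refine Finset.sum_congr rfl fun g _ => ?_
          rw [smul_comm g r a, smul_assoc] }
    refine ⟨Ext.mk₀ (ModuleCat.ofHom φ), ?_⟩
    rw [Ext.mk₀_comp_mk₀]
    congr 1
    ext s
    have h1 := hc s
    simp only [← hc', ← map_smul, ← map_sum] at h1
    exact h1.symm
  | succ j ih =>
    intro M _ _ _ _ ys hys hlen hreg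
    match ys, hlen with
    | y₁ :: ys, hlen =>
    rw [isWeaklyRegular_cons_iff] at hreg
    refine ext_step hinj (hys y₁ (by simp)) hreg.1 fun z => ⟨0, ?_⟩
    rw [ih _ ys (fun y hy => hys y (by simp [hy])) (by simpa using hlen) hreg.2 z, Ext.zero_comp]

end GenericExt

section Bridge
open CategoryTheory

lemma old_ext_subsingleton {R : Type} [CommRing R] (X Y : ModuleCat.{0} R) (j : ℕ)
    (h : ∀ z : Abelian.Ext X Y (j + 1), z = 0) :
    Subsingleton (((Ext R (ModuleCat.{0} R) (j + 1)).obj (Opposite.op X)).obj Y) := by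
  let P := projectiveResolution X
  have e := P.isoExt (R := R) (j + 1) Y
  suffices h0 : Limits.IsZero ((P.complex.linearYonedaObj R Y).homology (j + 1)) by
    exact ModuleCat.subsingleton_of_isZero (h0.of_iso e)
  rw [← HomologicalComplex.exactAt_iff_isZero_homology,
    HomologicalComplex.exactAt_iff' _ j (j + 1) (j + 2) (by simp) (by simp),
    ShortComplex.moduleCat_exact_iff]
  intro (x : P.complex.X (j + 1) ⟶ Y) hx
  have hx' : P.complex.d (j + 2) (j + 1) ≫ x = 0 := hx
  obtain ⟨g, hg⟩ := (P.extMk_eq_zero_iff x (j + 2) rfl hx' j rfl).1 (h _)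
  exact ⟨g, hg⟩

end Bridge

section Koz

theorem weakReg_powers (k : Type) [Field k] (d : ℕ) (L : Fin d → ℕ) :
    RingTheory.Sequence.IsWeaklyRegular (MvPolynomial (Fin d) k)
      (List.ofFn fun i => (X i : MvPolynomial (Fin d) k) ^ L i) := by
  rw [RingTheory.Sequence.isWeaklyRegular_iff]
  intro i hi
  have hid : i < d := by simpa using hi
  have hset : Ideal.ofList (List.take i (List.ofFn fun i => (X i : MvPolynomial (Fin d) k) ^ L i))
      = Ideal.span ((fun s => (monomial s) (1 : k)) ''
        {m | ∃ j : Fin d, j.1 < i ∧ m = Finsupp.single j (L j)}) := by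
    unfold Ideal.ofList
    congr 1
    ext f
    simp only [Set.mem_ofPred_eq, Set.mem_image, List.mem_take_iff_getElem, List.length_ofFn,
      List.getElem_ofFn, X_pow_eq_monomial]
    constructor
    · rintro ⟨j, hj, rfl⟩
      exact ⟨_, ⟨⟨j, by omega⟩, by simp; omega, rfl⟩, rfl⟩
    · rintro ⟨_, ⟨j, hj, rfl⟩, rfl⟩
      exact ⟨j.1, by omega, rfl⟩
  rw [hset]
  rw [isSMulRegular_iff_right_eq_zero_of_smul]
  intro x
  obtain ⟨f, rfl⟩ := Submodule.Quotient.mk_surjective _ x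
  rw [← Submodule.Quotient.mk_smul, Submodule.Quotient.mk_eq_zero, Submodule.Quotient.mk_eq_zero]
  simp only [smul_eq_mul, Ideal.mul_top, mem_ideal_span_monomial_image]
  simp only [List.getElem_ofFn, X_pow_eq_monomial]
  intro h m hm
  have h1 := h (Finsupp.single ⟨i, hid⟩ (L ⟨i, hid⟩) + m) (by
    rw [mem_support_iff, coeff_monomial_mul]
    simpa using hm)
  obtain ⟨_, ⟨j, hj, rfl⟩, hle⟩ := h1
  refine ⟨_, ⟨j, hj, rfl⟩, ?_⟩
  rw [Finsupp.single_le_iff] at hle ⊢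
  have : (⟨i, hid⟩ : Fin d) ≠ j := by
    rintro rfl
    simp at hj
  simpa [Finsupp.single_apply, this] using hle

end Koz

section Loc

theorem krull_le_of_integral (R S : Type) [CommRing R] [CommRing S] [Algebra R S]
    [Algebra.IsIntegral R S] (hinj : Function.Injective (algebraMap R S)) :
    ringKrullDim R ≤ ringKrullDim S := by
  unfold ringKrullDim
  refine iSup_le fun l => ?_
  obtain ⟨Q, -, hQ, hQ2⟩ := Ideal.exists_ideal_over_prime_of_isIntegral (S := S) l.head.asIdeal ⊥
    (by
      rw [Ideal.comap_bot_of_injective _ hinj]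
      exact bot_le)
  have : Q.LiesOver l.head.asIdeal := ⟨hQ2.symm⟩
  obtain ⟨L, hL, -⟩ := Ideal.exists_ltSeries_of_hasGoingUp l Q
  rw [← hL]
  exact le_iSup (fun p : LTSeries (PrimeSpectrum S) => ((p.length : ℕ) : WithBot ℕ∞)) L

theorem regular_params (R : Type) [CommRing R] (p : Ideal R) [hp : p.IsPrime] (n : ℕ)
    (h : IsLocalRing (Localization p.primeCompl))
    (s : Fin n → Localization p.primeCompl)
    (hs : Ideal.span (Set.range s) = @IsLocalRing.maximalIdeal _ _ h) :
    ∃ t : Fin n → R, (∀ i, t i ∈ p) ∧ ∀ r ∈ p, ∃ u, u ∉ p ∧ u * r ∈ Ideal.span (Set.range t) := by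
  have hm := IsLocalization.AtPrime.map_eq_maximalIdeal p (Localization p.primeCompl)
  have h1 : ∀ i, ∃ t : R, t ∈ p ∧ ∃ c, c ∉ p ∧ s i * algebraMap R _ c = algebraMap R _ t := by
    intro i
    have : s i ∈ Ideal.map (algebraMap R (Localization p.primeCompl)) p := by
      rw [hm, ← hs]
      exact Ideal.subset_span ⟨i, rfl⟩
    rw [IsLocalization.mem_map_algebraMap_iff p.primeCompl] at this
    obtain ⟨⟨a, b⟩, hx⟩ := this
    exact ⟨a, a.2, b, b.2, hx⟩
  choose t ht c hc hst using h1
  refine ⟨t, ht, fun r hr => ?_⟩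
  have hr1 : algebraMap R (Localization p.primeCompl) r ∈
      Ideal.map (algebraMap R (Localization p.primeCompl)) (Ideal.span (Set.range t)) := by
    have : algebraMap R (Localization p.primeCompl) r ∈ Ideal.span (Set.range s) := by
      rw [hs, ← hm]
      exact Ideal.mem_map_of_mem _ hr
    refine (Ideal.span_le.2 ?_) this
    rintro _ ⟨i, rfl⟩
    have hu : IsUnit (algebraMap R (Localization p.primeCompl) (c i)) :=
      IsLocalization.map_units (Localization p.primeCompl) (⟨c i, hc i⟩ : p.primeCompl)
    have : s i * algebraMap R (Localization p.primeCompl) (c i) ∈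
        Ideal.map (algebraMap R (Localization p.primeCompl)) (Ideal.span (Set.range t)) := by
      rw [hst]
      exact Ideal.mem_map_of_mem _ (Ideal.subset_span ⟨i, rfl⟩)
    exact (Ideal.mul_unit_mem_iff_mem _ hu).1 this
  rw [IsLocalization.algebraMap_mem_map_algebraMap_iff p.primeCompl] at hr1
  obtain ⟨u, hu, h2⟩ := hr1
  exact ⟨u, hu, h2⟩

end Loc
section DerGen

theorem der_poly_sub_mem {k S M : Type} [CommRing k] [CommRing S] [Algebra k S] [AddCommGroup M]
    [Module k M] [Module S M] (D : Derivation k S M) (N : Submodule S M)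
    (P : Polynomial S) (hP : ∀ i, D (P.coeff i) ∈ N) (s : S) :
    D (P.eval s) - P.derivative.eval s • D s ∈ N := by
  rw [Polynomial.derivative_eval, Polynomial.eval_eq_sum, Polynomial.sum, Polynomial.sum,
    map_sum, Finset.sum_smul, ← Finset.sum_sub_distrib]
  refine Submodule.sum_mem _ fun i _ => ?_
  rw [Derivation.leibniz, Derivation.leibniz_pow]
  have : P.coeff i • i • s ^ (i - 1) • D s + s ^ i • D (P.coeff i)
      - (P.coeff i * i * s ^ (i - 1)) • D s = s ^ i • D (P.coeff i) := by
    rw [mul_smul, mul_smul, Nat.cast_smul_eq_nsmul]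
    abel
  rw [this]
  exact N.smul_mem _ (hP i)

theorem der_prod_mem {k S M G : Type} [CommRing k] [CommRing S] [Algebra k S] [AddCommGroup M]
    [Module k M] [Module S M] [Group G] [Fintype G] [DecidableEq G] [MulSemiringAction G S]
    (D : Derivation k S M) (N : Submodule S M)
    (hN : ∀ r : S, (∀ g : G, g • r = r) → D r ∈ N) (s : S) :
    (∏ g ∈ (Finset.univ : Finset G).erase 1, (s - g • s)) • D s ∈ N := by
  have h1 := der_poly_sub_mem D N (MulSemiringAction.charpoly G s)
    (fun i => hN _ fun g => MulSemiringAction.smul_coeff_charpoly s i g) s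
  have h2 : MulSemiringAction.charpoly G s = (Polynomial.X - Polynomial.C s) *
      ∏ g ∈ (Finset.univ : Finset G).erase 1, (Polynomial.X - Polynomial.C (g • s)) := by
    rw [MulSemiringAction.charpoly_eq, ← Finset.mul_prod_erase _ _ (Finset.mem_univ (1 : G)),
      one_smul]
  rw [h2] at h1
  simp only [Polynomial.eval_mul, Polynomial.eval_sub, Polynomial.eval_X, Polynomial.eval_C,
    sub_self, zero_mul, map_zero, zero_sub, Polynomial.derivative_mul, Polynomial.derivative_sub,
    Polynomial.derivative_X, Polynomial.derivative_C, sub_zero, one_mul, Polynomial.eval_add,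
    add_zero, Polynomial.eval_prod, Submodule.neg_mem_iff] at h1
  exact h1

theorem exists_w {k S M : Type} [Field k] [CommRing S] [Algebra k S] [IsNoetherianRing S]
    [AddCommGroup M] [Module k M] [Module S M] [IsScalarTower k S M] [Module.Finite S M]
    (e : S →ₐ[k] k) (R : Subalgebra k S)
    (D : Derivation k S M) (ι : Type) [Fintype ι] (t : ι → R) (ht : ∀ i, e (t i) = 0)
    (h : ∀ r : R, e r = 0 → ∃ u : R, e u ≠ 0 ∧ u * r ∈ Ideal.span (Set.range t)) :
    ∃ w : S, e w ≠ 0 ∧ ∀ r : R, w • D r ∈ Submodule.span S (Set.range fun i => D (t i : S)) := by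
  set T := Submodule.span S (Set.range fun i => D (t i : S)) with hT
  set N := Submodule.span S (Set.range fun r : R => D (r : S)) with hN
  set q := RingHom.ker e with hq
  have hDN : ∀ r : R, D (r : S) ∈ N := fun r => Submodule.subset_span ⟨r, rfl⟩
  have hmain : ∀ r : R, D (r : S) ∈ T ⊔ q • N := by
    intro r
    set r0 : R := r - algebraMap k R (e r) with hr0
    have hr0S : (r0 : S) = r - algebraMap k S (e r) := rfl
    have hDr : D (r : S) = D (r0 : S) := by
      rw [hr0S, map_sub, D.map_algebraMap, sub_zero]
    have her0 : e (r0 : S) = 0 := by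
      rw [hr0S, map_sub, AlgHom.commutes]; simp
    obtain ⟨u, hu, hur⟩ := h r0 her0
    rw [Ideal.mem_span_range_iff_exists_fun] at hur
    obtain ⟨a, ha⟩ := hur
    have ha' : (u : S) * r0 = ∑ i, (a i : S) * t i := by
      have := congrArg (fun x : R => (x : S)) ha
      simpa using this.symm
    have hD := congrArg D ha'
    rw [Derivation.leibniz, map_sum] at hD
    have h1 : (u : S) • D (r0 : S) ∈ T ⊔ q • N := by
      have : (u : S) • D (r0 : S) = (∑ i, D ((a i : S) * t i)) - (r0 : S) • D (u : S) := by
        rw [← hD]; abel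
      rw [this]
      refine Submodule.sub_mem _ (Submodule.sum_mem _ fun i _ => ?_) ?_
      · rw [Derivation.leibniz]
        refine Submodule.add_mem _ (Submodule.mem_sup_left ?_) (Submodule.mem_sup_right ?_)
        · exact T.smul_mem _ (Submodule.subset_span ⟨i, rfl⟩)
        · exact Submodule.smul_mem_smul (ht i) (hDN _)
      · exact Submodule.mem_sup_right (Submodule.smul_mem_smul her0 (hDN _))
    have h2 : ((u : S) - algebraMap k S (e u)) • D (r0 : S) ∈ T ⊔ q • N :=
      Submodule.mem_sup_right (Submodule.smul_mem_smul
        (by rw [hq, RingHom.mem_ker, map_sub, AlgHom.commutes]; simp) (hDN _))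
    have h3 : algebraMap k S (e u) • D (r0 : S) ∈ T ⊔ q • N := by
      have := Submodule.sub_mem _ h1 h2
      rwa [← sub_smul, sub_sub_cancel] at this
    have h4 := (T ⊔ q • N).smul_mem (algebraMap k S (e u)⁻¹) h3
    rw [smul_smul, ← map_mul, inv_mul_cancel₀ hu, map_one, one_smul] at h4
    rwa [hDr]
  obtain ⟨w, hw, hwN⟩ := Submodule.exists_sub_one_mem_and_smul_le_of_fg_of_le_sup
    (I := q) (N := T) (N' := N) (P := N) (IsNoetherian.noetherian N) le_rfl
    (Submodule.span_le.2 (by rintro _ ⟨r, rfl⟩; exact hmain r))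
  refine ⟨w, ?_, fun r => hwN (Submodule.smul_mem_pointwise_smul _ _ _ (hDN r))⟩
  rw [hq, RingHom.mem_ker, map_sub, map_one, sub_eq_zero] at hw
  rw [hw]; exact one_ne_zero
end DerGen
section Act

variable {k d}

theorem matAct_X (M : Matrix (Fin d) (Fin d) k) (i : Fin d) :
    matAct k d M (X i) = ∑ j, M j i • X j := by
  simp [matAct]

/-- linear form with coefficient vector `c` -/
def linF (c : Fin d → k) : MvPolynomial (Fin d) k := ∑ i, c i • X i

theorem matAct_linF (M : Matrix (Fin d) (Fin d) k) (c : Fin d → k) :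
    matAct k d M (linF c) = linF (M *ᵥ c) := by
  simp only [linF, map_sum, map_smul, matAct_X, Matrix.mulVec, dotProduct, Finset.smul_sum,
    smul_smul, Finset.sum_smul]
  rw [Finset.sum_comm]
  refine Finset.sum_congr rfl fun i _ => Finset.sum_congr rfl fun j _ => ?_
  rw [mul_comm]

theorem X_eq_linF (i : Fin d) : (X i : MvPolynomial (Fin d) k) = linF (Pi.single i 1) := by
  simp [linF, Pi.single_apply]

theorem linF_sub (a b : Fin d → k) : linF (a - b) = linF a - linF b := by
  simp [linF, sub_smul]

theorem linF_add (a b : Fin d → k) : linF (a + b) = linF a + linF b := by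
  simp [linF, add_smul, Finset.sum_add_distrib]

theorem linF_smul (a : k) (b : Fin d → k) : linF (a • b) = a • linF b := by
  simp [linF, Finset.smul_sum, smul_smul]

theorem pderiv_linF (c : Fin d → k) (l : Fin d) : pderiv l (linF c) = C (c l) := by
  simp only [linF, map_sum]
  rw [Finset.sum_eq_single l]
  · simp [smul_eq_C_mul]
  · intro b _ hb
    rw [Derivation.map_smul, pderiv_X_of_ne hb, smul_zero]
  · simp

theorem linF_injective : Function.Injective (linF : (Fin d → k) → MvPolynomial (Fin d) k) := by
  intro a b h
  funext l
  have := congrArg (pderiv l) h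
  rw [pderiv_linF, pderiv_linF] at this
  exact C_injective _ _ this

theorem matAct_one (f : MvPolynomial (Fin d) k) : matAct k d 1 f = f := by
  have : matAct k d 1 = AlgHom.id k _ := by
    apply MvPolynomial.algHom_ext
    intro i
    rw [X_eq_linF, matAct_linF, Matrix.one_mulVec]; rfl
  rw [this]; rfl

theorem matAct_mul (M N : Matrix (Fin d) (Fin d) k) (f : MvPolynomial (Fin d) k) :
    matAct k d (M * N) f = matAct k d M (matAct k d N f) := by
  have : matAct k d (M * N) = (matAct k d M).comp (matAct k d N) := by
    apply MvPolynomial.algHom_ext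
    intro i
    rw [AlgHom.comp_apply, X_eq_linF, matAct_linF, matAct_linF, matAct_linF, Matrix.mulVec_mulVec]
  rw [this]; rfl

theorem eval_linF (v c : Fin d → k) : eval v (linF c) = v ⬝ᵥ c := by
  simp [linF, dotProduct, smul_eval, mul_comm]

theorem eval_matAct (v : Fin d → k) (M : Matrix (Fin d) (Fin d) k) (f : MvPolynomial (Fin d) k) :
    eval v (matAct k d M f) = eval (v ᵥ* M) f := by
  have : (eval v).comp (matAct k d M : MvPolynomial (Fin d) k →+* MvPolynomial (Fin d) k)
      = eval (v ᵥ* M) := by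
    apply MvPolynomial.ringHom_ext
    · intro r
      simp [matAct]
    · intro i
      rw [RingHom.comp_apply, X_eq_linF]
      erw [matAct_linF]
      rw [eval_linF, eval_linF, Matrix.dotProduct_mulVec]
  exact RingHom.congr_fun this f

theorem pderiv_matAct (M : Matrix (Fin d) (Fin d) k) (l : Fin d) (f : MvPolynomial (Fin d) k) :
    pderiv l (matAct k d M f) = ∑ i, M l i • matAct k d M (pderiv i f) := by
  induction f using MvPolynomial.induction_on with
  | C a => simp [matAct]
  | add p q hp hq => simp only [map_add, hp, hq, smul_add, Finset.sum_add_distrib]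
  | mul_X p n hp =>
    have h1 : pderiv l (matAct k d M (X n)) = C (M l n) := by
      rw [X_eq_linF, matAct_linF, pderiv_linF]
      simp
    rw [map_mul, pderiv_mul, hp, h1]
    simp only [pderiv_mul, map_add, map_mul, smul_add, Finset.sum_add_distrib]
    congr 1
    · rw [Finset.sum_mul]
      refine Finset.sum_congr rfl fun i _ => ?_
      rw [smul_mul_assoc]
    · rw [Finset.sum_eq_single n]
      · simp [smul_eq_C_mul, mul_comm]
      · intro b _ hb
        rw [pderiv_X_of_ne hb.symm]; simp
      · simp

instance actG (G : Subgroup (Matrix.SpecialLinearGroup (Fin d) k)) :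
    MulSemiringAction G (MvPolynomial (Fin d) k) where
  smul g f := matAct k d ((g : Matrix.SpecialLinearGroup (Fin d) k) : Matrix (Fin d) (Fin d) k) f
  one_smul f := matAct_one f
  mul_smul _ _ f := matAct_mul _ _ f
  smul_zero _ := map_zero _
  smul_add _ := map_add _
  smul_one _ := map_one _
  smul_mul _ := map_mul _

theorem actG_def (G : Subgroup (Matrix.SpecialLinearGroup (Fin d) k)) (g : G)
    (f : MvPolynomial (Fin d) k) : g • f =
    matAct k d ((g : Matrix.SpecialLinearGroup (Fin d) k) : Matrix (Fin d) (Fin d) k) f := rfl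

theorem mem_inv_iff (G : Subgroup (Matrix.SpecialLinearGroup (Fin d) k))
    (f : MvPolynomial (Fin d) k) : f ∈ invRSL k d G ↔ ∀ g : G, g • f = f :=
  ⟨fun h g => h g g.2, fun h g hg => h ⟨g, hg⟩⟩

instance actG_comm (G : Subgroup (Matrix.SpecialLinearGroup (Fin d) k)) :
    SMulCommClass G (invRSL k d G) (MvPolynomial (Fin d) k) where
  smul_comm g r f := by
    change g • ((r : MvPolynomial (Fin d) k) * f) = (r : MvPolynomial (Fin d) k) * (g • f)
    rw [smul_mul', (mem_inv_iff G _).1 r.2 g]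

instance actG_inv (G : Subgroup (Matrix.SpecialLinearGroup (Fin d) k)) :
    Algebra.IsInvariant (invRSL k d G) (MvPolynomial (Fin d) k) G where
  isInvariant b hb := ⟨⟨b, (mem_inv_iff G b).2 hb⟩, rfl⟩

/-- the gradient derivation -/
def gradD : Derivation k (MvPolynomial (Fin d) k) (Fin d → MvPolynomial (Fin d) k) :=
  mkDerivation k fun i => Pi.single i 1

theorem gradD_apply (f : MvPolynomial (Fin d) k) (l : Fin d) : gradD f l = pderiv l f := by
  induction f using MvPolynomial.induction_on with
  | C a => simp [gradD]
  | add p q hp hq => simp only [map_add, Pi.add_apply, hp, hq]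
  | mul_X p n hp =>
    rw [Derivation.leibniz, pderiv_mul, Pi.add_apply, Pi.smul_apply, Pi.smul_apply, hp]
    have : gradD (X n : MvPolynomial (Fin d) k) l = pderiv l (X n) := by
      simp [gradD, pderiv_X, Pi.single_apply, eq_comm]
    rw [this, smul_eq_mul, smul_eq_mul]; ring

end Act
section Free

variable {k d}

theorem exists_good_basis [CharZero k] {ι : Type} [Fintype ι] (W : ι → Submodule k (Fin d → k))
    (hW : ∀ g, W g ≠ ⊤) :
    ∃ c : Fin d → (Fin d → k), (∀ i g, c i ∉ W g) ∧ (Matrix.of c).det ≠ 0 := by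
  classical
  set U : Set (Fin d → k) := {c | ∀ g, c ∉ W g} with hU
  have hspan : Submodule.span k U = ⊤ := by
    by_contra hne
    have := Subspace.biUnion_ne_univ_of_top_notMem (k := k) (E := Fin d → k)
      (s := insert (Submodule.span k U) (Finset.univ.image W)) (by
        simp only [Finset.mem_insert, Finset.mem_image, Finset.mem_univ, true_and, not_or,
          not_exists]
        exact ⟨fun h => hne h.symm, hW⟩)
    apply this
    rw [Set.eq_univ_iff_forall]
    intro x
    by_cases hx : x ∈ U
    · simp only [Set.mem_iUnion]
      exact ⟨_, Finset.mem_insert_self _ _, Submodule.subset_span hx⟩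
    · simp only [hU, Set.mem_ofPred_eq, not_forall, not_not] at hx
      obtain ⟨g, hg⟩ := hx
      simp only [Set.mem_iUnion]
      exact ⟨W g, by simp, hg⟩
  obtain ⟨b, hbU, hbs, hbl⟩ := exists_linearIndependent k U
  let B : Module.Basis b k (Fin d → k) := Module.Basis.mk hbl (by
    rw [Subtype.range_coe, hbs, hspan])
  let e := B.indexEquiv (Pi.basisFun k (Fin d))
  refine ⟨fun i => (e.symm i : Fin d → k), fun i g => hbU (e.symm i).2 g, ?_⟩
  have : LinearIndependent k (Matrix.of fun i => (e.symm i : Fin d → k)).row :=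
    hbl.comp _ e.symm.injective
  rw [Matrix.linearIndependent_rows_iff_isUnit, Matrix.isUnit_iff_isUnit_det] at this
  exact this.ne_zero

/-- The gradient (Jacobian) matrix of a tuple. -/
def jacM (t : Fin d → MvPolynomial (Fin d) k) : Matrix (Fin d) (Fin d) (MvPolynomial (Fin d) k) :=
  Matrix.of fun j l => pderiv l (t j)

theorem jac_notMem [CharZero k] (G : Subgroup (Matrix.SpecialLinearGroup (Fin d) k)) [Fintype G]
    (t : Fin d → MvPolynomial (Fin d) k) (w : MvPolynomial (Fin d) k)
    (hw : ∀ r : invRSL k d G, w • gradD (r : MvPolynomial (Fin d) k) ∈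
      Submodule.span (MvPolynomial (Fin d) k) (Set.range fun i => gradD (t i)))
    (Q : Ideal (MvPolynomial (Fin d) k)) [hQ : Q.IsPrime] (hwQ : w ∉ Q)
    (hg : ∀ g : G, g ≠ 1 → ∃ c : Fin d → k, linF c - g • linF c ∉ Q) :
    (jacM t).det ∉ Q := by
  classical
  let W : {g : G // g ≠ 1} → Submodule k (Fin d → k) := fun g =>
    { carrier := {c | linF c - g.1 • linF c ∈ Q}
      add_mem' := by
        intro a b ha hb
        have := Q.add_mem ha hb
        simp only [Set.mem_ofPred_eq, linF_add, smul_add]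
        convert this using 1
        ring
      zero_mem' := by
        have : (linF (0 : Fin d → k)) = 0 := by simp [linF]
        simp [this]
      smul_mem' := by
        intro a b hb
        have := Q.mul_mem_left (C a) hb
        simp only [Set.mem_ofPred_eq, linF_smul, actG_def, map_smul] at this ⊢
        rw [smul_eq_C_mul, smul_eq_C_mul, ← mul_sub]
        exact this }
  obtain ⟨c, hc, hdet⟩ := exists_good_basis W (by
    intro g h
    obtain ⟨c, hc⟩ := hg g.1 g.2
    exact hc (by
      have : c ∈ W g := by rw [h]; trivial
      exact this))
  set b : Fin d → MvPolynomial (Fin d) k := fun i =>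
    w * ∏ g ∈ (Finset.univ : Finset G).erase 1, (linF (c i) - g • linF (c i)) with hb
  have hbQ : ∀ i, b i ∉ Q := by
    intro i h
    rcases hQ.mem_or_mem h with h | h
    · exact hwQ h
    · obtain ⟨g, hg1, hg2⟩ := (hQ.prod_mem_iff).1 h
      exact hc i ⟨g, (Finset.mem_erase.1 hg1).1⟩ hg2
  have hmem : ∀ i, ∃ a : Fin d → MvPolynomial (Fin d) k,
      ∑ j, a j • gradD (t j) = b i • gradD (linF (c i)) := by
    intro i
    rw [← Submodule.mem_span_range_iff_exists_fun]
    have h1 := der_prod_mem (G := G) (k := k) gradD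
      ((Submodule.span (MvPolynomial (Fin d) k) (Set.range fun i => gradD (t i))).comap
        (LinearMap.lsmul _ _ w))
      (fun r hr => hw ⟨r, (mem_inv_iff G r).2 hr⟩) (linF (c i))
    rw [Submodule.mem_comap, LinearMap.lsmul_apply, smul_smul] at h1
    exact h1
  choose a ha using hmem
  have hmat : Matrix.of a * jacM t = Matrix.diagonal b * (Matrix.of c).map C := by
    refine Matrix.ext fun i l => ?_
    rw [Matrix.diagonal_mul, Matrix.mul_apply]
    have := congrFun (ha i) l
    simpa [gradD_apply, pderiv_linF, jacM, Finset.sum_apply] using this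
  intro hJ
  have h2 := congrArg Matrix.det hmat
  rw [Matrix.det_mul, Matrix.det_mul, Matrix.det_diagonal] at h2
  have h3 : (∏ i, b i) * ((Matrix.of c).map C).det ∈ Q := by
    rw [← h2]; exact Q.mul_mem_left _ hJ
  rcases hQ.mem_or_mem h3 with h | h
  · obtain ⟨i, -, hi⟩ := hQ.prod_mem_iff.1 h
    exact hbQ i hi
  · have h4 : ((Matrix.of c).map (C : k →+* MvPolynomial (Fin d) k)).det
        = C ((Matrix.of c).det) := by
      rw [RingHom.map_det]; rfl
    rw [h4] at h
    exact hQ.ne_top (Q.eq_top_of_isUnit_mem h ((isUnit_iff_ne_zero.2 hdet).map C))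

end Free
section Free2

variable {k d}

theorem linF_deg (c : Fin d → k) : (linF c).totalDegree ≤ 1 := by
  unfold linF
  refine (totalDegree_finsetSum _ _).trans (Finset.sup_le fun i _ => ?_)
  exact (totalDegree_smul_le _ _).trans (totalDegree_X i).le

theorem linF_zero : linF (0 : Fin d → k) = 0 := by simp [linF]

theorem eq_zero_of_linF_eq (c : Fin d → k) (h : linF c = 0) : c = 0 :=
  linF_injective (h.trans linF_zero.symm)

/-- A nonunit dividing a nonzero linear form has degree one and is its multiple. -/
theorem smul_of_dvd (p : MvPolynomial (Fin d) k) (hp : ¬ IsUnit p) (u c : Fin d → k) (hu : u ≠ 0)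
    (h1 : p ∣ linF u) (h2 : p ∣ linF c) : ∃ a : k, c = a • u := by
  by_cases hc : c = 0
  · exact ⟨0, by simp [hc]⟩
  have key : ∀ e : Fin d → k, e ≠ 0 → p ∣ linF e → ∃ a : k, a ≠ 0 ∧ linF e = a • p := by
    rintro e he ⟨f, hf⟩
    have hne : linF e ≠ 0 := fun h => he (eq_zero_of_linF_eq e h)
    have hp0 : p ≠ 0 := by rintro rfl; simp at hf; exact hne hf
    have hf0 : f ≠ 0 := by rintro rfl; simp at hf; exact hne hf
    have hdeg := totalDegree_mul_of_isDomain hp0 hf0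
    rw [← hf] at hdeg
    have hle := linF_deg e
    have hpd : p.totalDegree ≠ 0 := by
      intro h
      rw [totalDegree_eq_zero_iff_eq_C] at h
      apply hp
      rw [h]
      refine (isUnit_iff_ne_zero.2 ?_).map C
      intro h'
      rw [h', C_0] at h
      exact hp0 h
    have hfd : f.totalDegree = 0 := by omega
    rw [totalDegree_eq_zero_iff_eq_C] at hfd
    refine ⟨coeff 0 f, ?_, ?_⟩
    · intro h'
      rw [h', C_0] at hfd
      exact hf0 hfd
    · rw [smul_eq_C_mul, ← hfd, mul_comm, ← hf]
  obtain ⟨a, ha, hau⟩ := key u hu h1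
  obtain ⟨b, hb, hbc⟩ := key c hc h2
  refine ⟨b * a⁻¹, linF_injective ?_⟩
  rw [linF_smul, hau, hbc, smul_smul, mul_assoc, inv_mul_cancel₀ ha, mul_one]

theorem no_transvection [CharZero k] (M : Matrix (Fin d) (Fin d) k) (hdet : M.det = 1) (n : ℕ)
    (hn : 0 < n) (hM : M ^ n = 1) (u : Fin d → k) (h : ∀ c, ∃ a : k, M *ᵥ c - c = a • u) :
    M = 1 := by
  choose a ha using h
  set φ : Fin d → k := fun i => a (Pi.single i 1) with hφ
  have h1 : M = 1 + Matrix.vecMulVec u φ := by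
    ext i j
    have := congrFun (ha (Pi.single j 1)) i
    rw [Pi.sub_apply, Matrix.mulVec_single_one, Pi.smul_apply, smul_eq_mul, sub_eq_iff_eq_add]
      at this
    rw [Matrix.add_apply, Matrix.vecMulVec_apply, Matrix.one_apply]
    rw [Matrix.col_apply] at this
    rw [this, Pi.single_apply, add_comm, mul_comm]
  have h2 : φ ⬝ᵥ u = 0 := by
    have := Matrix.det_one_add_replicateCol_mul_replicateRow (ι := Unit) u φ
    rw [← Matrix.vecMulVec_eq, ← h1, hdet] at this
    linear_combination -this
  set E := Matrix.vecMulVec u φ with hE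
  have h3 : E * E = 0 := by
    rw [hE, Matrix.vecMulVec_mul_vecMulVec, h2]
    simp
  have h4 : ∀ m : ℕ, M ^ m = 1 + m • E := by
    intro m
    induction m with
    | zero => simp
    | succ m ih =>
      rw [pow_succ, ih, h1, mul_add, mul_one, add_mul, one_mul, smul_mul_assoc, h3, smul_zero,
        add_zero, add_assoc, succ_nsmul]
  have h5 := h4 n
  rw [hM] at h5
  have h6 : n • E = 0 := by simpa using h5.symm
  have h7 : E = 0 := by
    rw [← Nat.cast_smul_eq_nsmul k] at h6
    rcases smul_eq_zero.1 h6 with h | h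
    · rw [Nat.cast_eq_zero] at h
      omega
    · exact h
  rw [h1, h7, add_zero]

theorem not_dvd_all [CharZero k] (G : Subgroup (Matrix.SpecialLinearGroup (Fin d) k)) [Fintype G]
    (p : MvPolynomial (Fin d) k) (hp : ¬ IsUnit p) (g : G) (hg : g ≠ 1) :
    ∃ c : Fin d → k, ¬ p ∣ linF c - g • linF c := by
  by_contra! h
  set M : Matrix (Fin d) (Fin d) k := ((g : Matrix.SpecialLinearGroup (Fin d) k) :
    Matrix (Fin d) (Fin d) k) with hM
  have h' : ∀ c : Fin d → k, p ∣ linF (M *ᵥ c - c) := by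
    intro c
    have := h c
    rw [actG_def, matAct_linF] at this
    rw [linF_sub]
    exact (dvd_sub_comm).1 this
  apply hg
  have hM1 : M = 1 → g = 1 := by
    intro h1
    apply Subtype.ext
    apply Subtype.ext
    exact h1
  apply hM1
  by_cases hall : ∀ c, M *ᵥ c - c = 0
  · apply Matrix.ext_of_mulVec_single
    intro i
    rw [Matrix.one_mulVec]
    exact sub_eq_zero.1 (hall _)
  · push Not at hall
    obtain ⟨c0, hc0⟩ := hall
    refine no_transvection M (g : Matrix.SpecialLinearGroup (Fin d) k).2 (Fintype.card G)
      Fintype.card_pos ?_ (M *ᵥ c0 - c0) (fun c => smul_of_dvd p hp _ _ hc0 (h' c0) (h' c))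
    have h8 : (g : Matrix.SpecialLinearGroup (Fin d) k) ^ Fintype.card G = 1 :=
      congrArg Subtype.val (pow_card_eq_one (x := g))
    rw [hM, ← Matrix.SpecialLinearGroup.coe_pow, h8, Matrix.SpecialLinearGroup.coe_one]

theorem jac_eval_ne [CharZero k] (G : Subgroup (Matrix.SpecialLinearGroup (Fin d) k)) [Fintype G]
    (t : Fin d → MvPolynomial (Fin d) k) (w : MvPolynomial (Fin d) k)
    (hw : ∀ r : invRSL k d G, w • gradD (r : MvPolynomial (Fin d) k) ∈
      Submodule.span (MvPolynomial (Fin d) k) (Set.range fun i => gradD (t i)))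
    (v : Fin d → k) (hwv : eval v w ≠ 0) :
    eval v (jacM t).det ≠ 0 := by
  intro hJ
  have hJ0 : (jacM t).det ≠ 0 := by
    have := jac_notMem G t w hw ⊥ (by
      rw [Ideal.mem_bot]; rintro rfl; simp at hwv) (by
      intro g hg
      obtain ⟨c, hc⟩ := not_dvd_all G 0 not_isUnit_zero g hg
      refine ⟨c, fun h => hc ?_⟩
      rw [Ideal.mem_bot] at h
      rw [h])
    rwa [Ideal.mem_bot] at this
  obtain ⟨F, hF, hFJ⟩ := UniqueFactorizationMonoid.exists_prime_factors _ hJ0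
  set q := RingHom.ker (eval v) with hq
  have hqp : q.IsPrime := RingHom.ker_isPrime _
  have h1 : F.prod ∈ q := by
    obtain ⟨a, ha⟩ := hFJ
    have : F.prod * a ∈ q := by rw [ha]; exact hJ
    exact (Ideal.mul_unit_mem_iff_mem _ a.isUnit).1 this
  rw [hqp.multiset_prod_mem_iff_exists_mem] at h1
  obtain ⟨p, hpF, hpq⟩ := h1
  have hpp := hF p hpF
  have : (Ideal.span {p}).IsPrime := (Ideal.span_singleton_prime hpp.ne_zero).2 hpp
  refine jac_notMem G t w hw (Ideal.span {p}) ?_ ?_ ?_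
  · intro h
    have : Ideal.span {p} ≤ q := (Ideal.span_singleton_le_iff_mem _).2 hpq
    exact hwv (this h)
  · intro g hg
    obtain ⟨c, hc⟩ := not_dvd_all G p hpp.not_isUnit g hg
    exact ⟨c, fun h => hc (Ideal.mem_span_singleton.1 h)⟩
  · rw [Ideal.mem_span_singleton]
    exact (Multiset.dvd_prod hpF).trans hFJ.dvd

theorem fixed_eq_one (t : Fin d → MvPolynomial (Fin d) k) (v : Fin d → k)
    (hJ : eval v (jacM t).det ≠ 0) (M : Matrix (Fin d) (Fin d) k)
    (ht : ∀ j, matAct k d M (t j) = t j) (hv : v ᵥ* M = v) : M = 1 := by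
  set A : Matrix (Fin d) (Fin d) k := (jacM t).map (eval v) with hA
  have hAdet : A.det ≠ 0 := by
    rw [RingHom.map_det] at hJ; exact hJ
  have h1 : A * Mᵀ = A := by
    ext j l
    have := congrArg (eval v) (pderiv_matAct M l (t j))
    rw [ht] at this
    simp only [map_sum, smul_eval, eval_matAct, hv] at this
    rw [Matrix.mul_apply]
    simp only [hA, Matrix.map_apply, jacM, Matrix.of_apply, Matrix.transpose_apply]
    rw [this]
    exact Finset.sum_congr rfl fun i _ => mul_comm _ _
  have h2 : Mᵀ = 1 := by
    have hu : IsUnit A := by rw [Matrix.isUnit_iff_isUnit_det]; exact isUnit_iff_ne_zero.2 hAdet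
    exact hu.mul_left_cancel (by rw [h1, mul_one])
  rw [← Matrix.transpose_transpose M, h2, Matrix.transpose_one]

end Free2
section Glue

variable {k d}

theorem eval_prod_smul (G : Subgroup (Matrix.SpecialLinearGroup (Fin d) k)) [Fintype G]
    (f : MvPolynomial (Fin d) k) : ∃ r : invRSL k d G, (r : MvPolynomial (Fin d) k) = ∏ g : G, g • f := by
  refine ⟨⟨∏ g : G, g • f, (mem_inv_iff G _).2 fun h => ?_⟩, rfl⟩
  rw [Finset.smul_prod']
  simp only [smul_smul]
  exact Fintype.prod_bijective (fun g => h * g) (Group.mulLeft_bijective h) _ _ fun _ => rfl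

theorem mem_span_X_iff (f : MvPolynomial (Fin d) k) :
    f ∈ Ideal.span (Set.range (X : Fin d → MvPolynomial (Fin d) k)) ↔ eval 0 f = 0 := by
  set I := Ideal.span (Set.range (X : Fin d → MvPolynomial (Fin d) k)) with hI
  have hsub : ∀ f : MvPolynomial (Fin d) k, f - C (eval 0 f) ∈ I := by
    intro f
    induction f using MvPolynomial.induction_on with
    | C a => simp
    | add p q hp hq =>
      have := I.add_mem hp hq
      rw [map_add, map_add]
      convert this using 1
      ring
    | mul_X p n hp =>
      simpa using I.mul_mem_left p (Ideal.subset_span ⟨n, rfl⟩)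
  constructor
  · intro h
    have hle : I ≤ RingHom.ker (eval (0 : Fin d → k)) := by
      rw [hI, Ideal.span_le]
      rintro _ ⟨i, rfl⟩
      simp
    exact hle h
  · intro h
    have := hsub f
    rwa [h, C_0, sub_zero] at this

theorem free_det [CharZero k] (G : Subgroup (Matrix.SpecialLinearGroup (Fin d) k)) [Fintype G]
    (hiso : IsIsolatedSing k d G) (g : G) (hg : g ≠ 1) :
    (((g : Matrix.SpecialLinearGroup (Fin d) k) : Matrix (Fin d) (Fin d) k) - 1).det ≠ 0 := by
  intro hdet
  set M : Matrix (Fin d) (Fin d) k := ((g : Matrix.SpecialLinearGroup (Fin d) k) :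
    Matrix (Fin d) (Fin d) k) with hM
  obtain ⟨v, hv0, hv⟩ := Matrix.exists_vecMul_eq_zero_iff.2 hdet
  rw [Matrix.vecMul_sub, Matrix.vecMul_one, sub_eq_zero] at hv
  let e : MvPolynomial (Fin d) k →ₐ[k] k := aeval v
  have he : ∀ f, e f = eval v f := fun f => by simp [e, aeval_eq_eval]
  let p : Ideal (invRSL k d G) := (RingHom.ker e).comap
    (algebraMap (invRSL k d G) (MvPolynomial (Fin d) k))
  have hkp : (RingHom.ker e).IsPrime := RingHom.ker_isPrime _
  have hp : p.IsPrime := Ideal.comap_isPrime _ _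
  have hmemp : ∀ r : invRSL k d G, r ∈ p ↔ e r = 0 := fun r => Iff.rfl
  have hpne : p ≠ irrId k d G := by
    intro hpe
    apply hv0
    funext i
    obtain ⟨r, hr⟩ := eval_prod_smul G (X i - C (v i))
    have h1 : r ∈ p := by
      rw [hmemp, he, hr, eval_prod]
      refine Finset.prod_eq_zero (Finset.mem_univ 1) ?_
      simp
    rw [hpe] at h1
    have h2 : eval 0 (r : MvPolynomial (Fin d) k) = 0 := (mem_span_X_iff _).1 h1
    rw [hr, eval_prod, Finset.prod_eq_zero_iff] at h2
    obtain ⟨h, -, h2⟩ := h2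
    rw [actG_def, eval_matAct, Matrix.zero_vecMul] at h2
    simpa using h2
  obtain ⟨-, hloc, n, s, hs, hn⟩ := hiso p hp hpne
  have hnd : n ≤ d := by
    rw [IsLocalization.AtPrime.ringKrullDim_eq_height p] at hn
    have h1 : (p.height : WithBot ℕ∞) ≤ ringKrullDim (invRSL k d G) :=
      Ideal.height_le_ringKrullDim_of_isPrime
    have : Algebra.IsIntegral (invRSL k d G) (MvPolynomial (Fin d) k) :=
      Algebra.IsInvariant.isIntegral _ _ G
    have h2 := krull_le_of_integral (invRSL k d G) (MvPolynomial (Fin d) k) Subtype.val_injective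
    have h3 := h1.trans h2
    rw [hn, MvPolynomial.ringKrullDim_of_isNoetherianRing, ringKrullDim_eq_zero_of_field, zero_add,
      Nat.card_eq_fintype_card, Fintype.card_fin] at h3
    exact_mod_cast h3
  obtain ⟨t0, ht0, hspan⟩ := regular_params (invRSL k d G) p n hloc s hs
  let t : Fin d → invRSL k d G := fun i => if h : i.1 < n then t0 ⟨i.1, h⟩ else 0
  have ht : ∀ i, e (t i) = 0 := by
    intro i
    rw [← hmemp]
    dsimp only [t]
    split_ifs
    · exact ht0 _
    · exact p.zero_mem
  have hle : Ideal.span (Set.range t0) ≤ Ideal.span (Set.range t) := by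
    refine Ideal.span_mono ?_
    rintro _ ⟨i, rfl⟩
    exact ⟨⟨i.1, i.2.trans_le hnd⟩, by simp [t]⟩
  obtain ⟨w, hw, hwD⟩ := exists_w e (invRSL k d G) gradD (Fin d) t ht (by
    intro r hr
    obtain ⟨u, hu, hur⟩ := hspan r hr
    exact ⟨u, hu, hle hur⟩)
  have hJ := jac_eval_ne G (fun i => (t i : MvPolynomial (Fin d) k)) w hwD v (by rwa [he] at hw)
  have hM1 := fixed_eq_one _ v hJ M (fun j => (t j).2 g g.2) hv
  apply hg
  apply Subtype.ext
  apply Subtype.ext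
  exact hM1

theorem X_mem_rad_good [CharZero k] (G : Subgroup (Matrix.SpecialLinearGroup (Fin d) k)) [Fintype G]
    (hiso : IsIsolatedSing k d G) (i : Fin d) :
    (X i : MvPolynomial (Fin d) k) ∈ (goodIdeal (MvPolynomial (Fin d) k) G).radical := by
  have h1 : ∀ g : G, ∃ s : MvPolynomial (Fin d) k, g ≠ 1 → s - g⁻¹ • s = X i := by
    intro g
    by_cases hg : g = 1
    · exact ⟨0, fun h => absurd hg h⟩
    have hdet := free_det G hiso g⁻¹ (by simpa using hg)
    set M : Matrix (Fin d) (Fin d) k := (((g⁻¹ : G) : Matrix.SpecialLinearGroup (Fin d) k) :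
      Matrix (Fin d) (Fin d) k) with hM
    have hu : IsUnit (M - 1).det := isUnit_iff_ne_zero.2 hdet
    refine ⟨linF ((M - 1)⁻¹ *ᵥ (-(Pi.single i 1))), fun _ => ?_⟩
    rw [actG_def, matAct_linF, ← linF_sub, X_eq_linF]
    congr 1
    set c := (M - 1)⁻¹ *ᵥ (-(Pi.single i (1 : k))) with hc
    have h2 : (M - 1) *ᵥ c = -(Pi.single i 1) := by
      rw [hc, Matrix.mulVec_mulVec, Matrix.mul_nonsing_inv _ hu, Matrix.one_mulVec]
    rw [Matrix.sub_mulVec, Matrix.one_mulVec] at h2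
    rw [← neg_sub, h2, neg_neg]
  choose s hs using h1
  exact ⟨_, prod_mem_goodIdeal s (X i) hs⟩

theorem X_mem_rad_inv [CharZero k] (G : Subgroup (Matrix.SpecialLinearGroup (Fin d) k)) [Fintype G]
    (hiso : IsIsolatedSing k d G) (i : Fin d) :
    (X i : MvPolynomial (Fin d) k) ∈
      (invGood (invRSL k d G) (MvPolynomial (Fin d) k) G).radical := by
  set I := Ideal.span (Set.range (X : Fin d → MvPolynomial (Fin d) k)) with hI
  have h1 := mem_radical_of_stable (R := invRSL k d G) (G := G) I (by
    intro g f hf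
    rw [hI, mem_span_X_iff] at hf ⊢
    rw [actG_def, eval_matAct, Matrix.zero_vecMul, hf]) (X i) (Ideal.subset_span ⟨i, rfl⟩)
  have hIg : I ≤ (goodIdeal (MvPolynomial (Fin d) k) G).radical := by
    rw [hI, Ideal.span_le]
    rintro _ ⟨j, rfl⟩
    exact X_mem_rad_good G hiso j
  refine (Ideal.radical_le_radical_iff.2 ?_) h1
  rw [Ideal.map_le_iff_le_comap]
  intro r hr
  obtain ⟨n, hn⟩ := hIg hr
  refine ⟨n, ?_⟩
  rw [← map_pow] at hn ⊢
  exact Ideal.subset_span ⟨r ^ n, hn, rfl⟩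

end Glue

open CategoryTheory in
/-- **Statement 15** (step (i) of the proof of Theorem 4.2): let `G ≤ SL_d(k)` be finite
(char `k` = 0) with `R = S^G` an isolated singularity.  Then `Ext^j_R(S, S) = 0` for all
`0 < j < d - 1`. -/
theorem stmt_15 [CharZero k] (G : Subgroup (Matrix.SpecialLinearGroup (Fin d) k))
    [Fintype G] (hiso : IsIsolatedSing k d G) (j : ℕ) (h0 : 0 < j) (hj : j + 1 < d) :
    Subsingleton
      (((Ext ↥(invRSL k d G) (ModuleCat ↥(invRSL k d G)) j).obj
          (Opposite.op (ModuleCat.of ↥(invRSL k d G) (MvPolynomial (Fin d) k)))).obj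
        (ModuleCat.of ↥(invRSL k d G) (MvPolynomial (Fin d) k))) := by
  have hX := X_mem_rad_inv G hiso
  choose L hL using hX
  obtain ⟨j, rfl⟩ : ∃ j', j = j' + 1 := ⟨j - 1, by omega⟩
  refine old_ext_subsingleton _ _ j ?_
  refine ext_vanish (G := G) Subtype.val_injective j (MvPolynomial (Fin d) k)
    (List.ofFn fun i => (X i : MvPolynomial (Fin d) k) ^ L i) ?_ (by simpa using by omega)
    (weakReg_powers k d L)
  intro y hy
  rw [List.mem_ofFn] at hy
  obtain ⟨i, rfl⟩ := hy
  exact hL i
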